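/- Let q be a real number with 0 < q < 1 (viewed as a complex number) and let γ, σ be complex numbers, where q^γ := exp(γ log q). Then for every natural number n: ∑_{k=0}^{n} (γ)_{n−k,q} · q^{γk} · (σ)_{k,q} = (γ+σ)_{n,q}. -/

import Mathlib

noncomputable section

open scoped BigOperators

/-- The finite q-shifted factorial `(z; q)_n = ∏_{i=0}^{n-1} (1 - z q^i)` for complex `z`. -/
def qPochC (q : ℝ) (z : ℂ) (n : ℕ) : ℂ := ∏ i ∈ Finset.range n, (1 - z * (q : ℂ) ^ i)

/-- The q-Pochhammer symbol `(γ)_{n,q} = (q^γ; q)_n / (q; q)_n` for complex `γ`. -/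
def qPochRatC (q : ℝ) (γ : ℂ) (n : ℕ) : ℂ := qPochC q ((q : ℂ) ^ γ) n / qPochC q (q : ℂ) n

open Finset.HasAntidiagonal (antidiagonal mem_antidiagonal)

theorem qPochC_succ (q : ℝ) (z : ℂ) (n : ℕ) :
    qPochC q z (n + 1) = qPochC q z n * (1 - z * (q : ℂ) ^ n) :=
  Finset.prod_range_succ _ _

theorem one_sub_pow_succ_ne_zero {q : ℝ} (hq0 : 0 < q) (hq1 : q < 1) (n : ℕ) :
    (1 : ℂ) - (q : ℂ) ^ (n + 1) ≠ 0 := by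
  have h : (1 : ℝ) - q ^ (n + 1) ≠ 0 :=
    (sub_pos.2 (pow_lt_one₀ hq0.le hq1 n.succ_ne_zero)).ne'
  exact_mod_cast h

/-- The recurrence in `n` of the quotient `(z; q)_n / (q; q)_n`. -/
theorem one_sub_pow_mul_qPochC_div_succ {q : ℝ} (hq0 : 0 < q) (hq1 : q < 1) (z : ℂ) (n : ℕ) :
    (1 - (q : ℂ) ^ (n + 1)) * (qPochC q z (n + 1) / qPochC q q (n + 1)) =
      (1 - z * (q : ℂ) ^ n) * (qPochC q z n / qPochC q q n) := by
  have h := one_sub_pow_succ_ne_zero hq0 hq1 n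
  rw [qPochC_succ, qPochC_succ, ← pow_succ', mul_div_mul_comm]
  field_simp

/-- The `q`-Chu–Vandermonde convolution for the quotients `(z; q)_n / (q; q)_n`. -/
theorem sum_antidiagonal_qPochC_div {q : ℝ} (hq0 : 0 < q) (hq1 : q < 1) (a b : ℂ) (n : ℕ) :
    ∑ p ∈ antidiagonal n,
        qPochC q a p.1 / qPochC q q p.1 * a ^ p.2 * (qPochC q b p.2 / qPochC q q p.2) =
      qPochC q (a * b) n / qPochC q q n := by
  induction n with
  | zero => simp [qPochC]
  | succ n ih =>
    apply mul_left_cancel₀ (one_sub_pow_succ_ne_zero hq0 hq1 n)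
    rw [one_sub_pow_mul_qPochC_div_succ hq0 hq1, ← ih]
    set A : ℕ → ℂ := fun i => qPochC q a i / qPochC q q i
    set B : ℕ → ℂ := fun j => qPochC q b j / qPochC q q j
    have hA (i : ℕ) : (1 - (q : ℂ) ^ (i + 1)) * A (i + 1) = (1 - a * (q : ℂ) ^ i) * A i :=
      one_sub_pow_mul_qPochC_div_succ hq0 hq1 a i
    have hB (j : ℕ) : (1 - (q : ℂ) ^ (j + 1)) * B (j + 1) = (1 - b * (q : ℂ) ^ j) * B j :=
      one_sub_pow_mul_qPochC_div_succ hq0 hq1 b j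
    change _ * ∑ p ∈ antidiagonal (n + 1), A p.1 * a ^ p.2 * B p.2 =
      _ * ∑ p ∈ antidiagonal n, A p.1 * a ^ p.2 * B p.2
    calc
      _ = ∑ p ∈ antidiagonal (n + 1), (1 - (q : ℂ) ^ p.1) * A p.1 * a ^ p.2 * B p.2 +
          ∑ p ∈ antidiagonal (n + 1),
            (q : ℂ) ^ p.1 * A p.1 * a ^ p.2 * ((1 - (q : ℂ) ^ p.2) * B p.2) := by
        rw [Finset.mul_sum, ← Finset.sum_add_distrib]
        refine Finset.sum_congr rfl fun p hp => ?_
        rw [← mem_antidiagonal.1 hp]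
        ring
      _ = ∑ p ∈ antidiagonal n, (1 - a * (q : ℂ) ^ p.1) * A p.1 * a ^ p.2 * B p.2 +
          ∑ p ∈ antidiagonal n,
            (q : ℂ) ^ p.1 * A p.1 * a ^ (p.2 + 1) * ((1 - b * (q : ℂ) ^ p.2) * B p.2) := by
        rw [Finset.Nat.sum_antidiagonal_succ, Finset.Nat.sum_antidiagonal_succ']
        simp only [hA, hB, pow_zero, sub_self, zero_mul, mul_zero, zero_add]
      _ = _ := by
        rw [Finset.mul_sum, ← Finset.sum_add_distrib]
        refine Finset.sum_congr rfl fun p hp => ?_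
        rw [← mem_antidiagonal.1 hp]
        ring

/-- For `0 < q < 1` and complex `γ, σ`, and every natural `n`:
`∑_{k=0}^{n} (γ)_{n-k,q} q^{γ k} (σ)_{k,q} = (γ+σ)_{n,q}`. -/
theorem qPochRat_add (q : ℝ) (hq0 : 0 < q) (hq1 : q < 1) (γ σ : ℂ) (n : ℕ) :
    ∑ k ∈ Finset.range (n + 1),
        qPochRatC q γ (n - k) * (q : ℂ) ^ (γ * (k : ℂ)) * qPochRatC q σ k =
      qPochRatC q (γ + σ) n := by
  have hq : (q : ℂ) ≠ 0 := Complex.ofReal_ne_zero.2 hq0.ne'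
  simp only [qPochRatC, Complex.cpow_add _ _ hq, Complex.cpow_mul_nat]
  rw [← sum_antidiagonal_qPochC_div hq0 hq1, ← Finset.Nat.sum_antidiagonal_swap,
    Finset.Nat.sum_antidiagonal_eq_sum_range_succ_mk]
  rfl
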